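/- arXiv:2201.02701 — 2 statements merged into one kernel-verified Lean document; each statement's English description precedes it below -/
import Mathlib

section
/- Let p be a point of the generalized hermitian unital H(C|R), let X, Y, Z be three distinct blocks through p, and let B and B' be two disjoint blocks, neither containing p, such that each of B and B' meets each of X, Y and Z. Let ℓ_B and ℓ_{B'} be the lines of PG(2,C) containing B and B' respectively (these lines are distinct), and let T be any line of PG(2,C) with T ∩ H = {p} (a tangent line to H(C|R) at p). Then the unique intersection point of ℓ_B and ℓ_{B'} in PG(2,C) lies on T. -/
noncomputable section

/-- A line of the projective plane `PG(2,C)`: the zero set of a nonzero linear form. -/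
def IsLine (C : Type*) [Field C] (ℓ : Set (Projectivization C (Fin 3 → C))) : Prop :=
  ∃ f : (Fin 3 → C) →ₗ[C] C, f ≠ 0 ∧ ℓ = {P : Projectivization C (Fin 3 → C) | f P.rep = 0}

/-- The point set of the generalized hermitian unital `H(C|R)`:
points `[X,Y,Z]` with `σ(X)·Y + σ(Z)·Z ∈ εR`. -/
def hermSet {C : Type*} [Field C] (R : Subfield C) (σ : C →+* C) (ε : C) :
    Set (Projectivization C (Fin 3 → C)) :=
  {P | ∃ v : Fin 3 → C, ∃ hv : v ≠ 0, P = Projectivization.mk C v hv ∧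
        ∃ r ∈ R, σ (v 0) * v 1 + σ (v 2) * v 2 = ε * r}

/-- A block of `H(C|R)`: the trace of a line meeting the point set in at least two points. -/
def IsHermBlock {C : Type*} [Field C] (R : Subfield C) (σ : C →+* C) (ε : C)
    (B : Set (Projectivization C (Fin 3 → C))) : Prop :=
  ∃ ℓ, IsLine C ℓ ∧ (hermSet R σ ε ∩ ℓ).Nontrivial ∧ B = hermSet R σ ε ∩ ℓ

open Module

section Forms

variable {C : Type*} [Field C]

theorem exists_eq_smul_add_smul_of_apply_eq_zero {f : (Fin 3 → C) →ₗ[C] C} (hf : f ≠ 0)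
    {u v w : Fin 3 → C} (hu : f u = 0) (hv : f v = 0) (hw : f w = 0)
    (huv : LinearIndependent C ![u, v]) : ∃ a b : C, w = a • u + b • v := by
  have hker : finrank C (LinearMap.ker f) + 1 = finrank C (Fin 3 → C) :=
    Module.Dual.finrank_ker_add_one_of_ne_zero hf
  have hle : Submodule.span C (Set.range ![u, v]) ≤ LinearMap.ker f := by
    rw [Submodule.span_le]
    rintro _ ⟨i, rfl⟩
    fin_cases i <;> simpa
  have heq := Submodule.eq_of_le_of_finrank_eq hle (by
    rw [finrank_span_eq_card huv]
    simp at hker ⊢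
    omega)
  have hmem : w ∈ Submodule.span C (Set.range ![u, v]) := by
    rw [heq]
    exact hw
  rw [Matrix.range_cons, Matrix.range_cons, Matrix.range_empty, Set.union_empty] at hmem
  obtain ⟨a, b, h⟩ := Submodule.mem_span_pair.1 hmem
  exact ⟨a, b, h.symm⟩

theorem apply_mk_rep_eq_zero_iff (f : (Fin 3 → C) →ₗ[C] C) {v : Fin 3 → C} (hv : v ≠ 0) :
    f (Projectivization.mk C v hv).rep = 0 ↔ f v = 0 := by
  obtain ⟨a, ha⟩ := Projectivization.exists_smul_eq_mk_rep C v hv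
  rw [← ha]
  simp [Units.smul_def]

theorem linearIndependent_rep {P Q : Projectivization C (Fin 3 → C)} (h : P ≠ Q) :
    LinearIndependent C ![P.rep, Q.rep] := by
  have := Projectivization.independent_iff.1 ((Projectivization.independent_pair_iff_ne P Q).2 h)
  rwa [show Projectivization.rep ∘ ![P, Q] = ![P.rep, Q.rep] by
    ext i : 1; fin_cases i <;> rfl] at this

/-- A nonzero form vanishing on two independent vectors is determined up to its kernel. -/
theorem apply_eq_zero_of_apply_eq_zero {f g : (Fin 3 → C) →ₗ[C] C} (hf : f ≠ 0)
    {u v w : Fin 3 → C} (huv : LinearIndependent C ![u, v]) (hfu : f u = 0) (hfv : f v = 0)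
    (hgu : g u = 0) (hgv : g v = 0) (hw : f w = 0) : g w = 0 := by
  obtain ⟨a, b, rfl⟩ := exists_eq_smul_add_smul_of_apply_eq_zero hf hfu hfv hw huv
  simp [hgu, hgv]

theorem setOf_rep_eq_of_linearIndependent {f g : (Fin 3 → C) →ₗ[C] C} (hf : f ≠ 0) (hg : g ≠ 0)
    {u v : Fin 3 → C} (huv : LinearIndependent C ![u, v]) (hfu : f u = 0) (hfv : f v = 0)
    (hgu : g u = 0) (hgv : g v = 0) :
    {P : Projectivization C (Fin 3 → C) | f P.rep = 0} = {P | g P.rep = 0} :=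
  Set.ext fun _ => ⟨apply_eq_zero_of_apply_eq_zero hf huv hfu hfv hgu hgv,
    apply_eq_zero_of_apply_eq_zero hg huv hgu hgv hfu hfv⟩

theorem IsLine.eq_of_mem {ℓ ℓ' : Set (Projectivization C (Fin 3 → C))} (h : IsLine C ℓ)
    (h' : IsLine C ℓ') {P Q : Projectivization C (Fin 3 → C)} (hPQ : P ≠ Q) (hP : P ∈ ℓ)
    (hQ : Q ∈ ℓ) (hP' : P ∈ ℓ') (hQ' : Q ∈ ℓ') : ℓ = ℓ' := by
  obtain ⟨f, hf, rfl⟩ := h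
  obtain ⟨g, hg, rfl⟩ := h'
  exact setOf_rep_eq_of_linearIndependent hf hg (linearIndependent_rep hPQ) hP hQ hP' hQ'

theorem exists_ne_zero_apply_eq_zero (f g : (Fin 3 → C) →ₗ[C] C) :
    ∃ w : Fin 3 → C, w ≠ 0 ∧ f w = 0 ∧ g w = 0 := by
  have h : LinearMap.ker (f.prod g) ≠ ⊥ := LinearMap.ker_ne_bot_of_finrank_lt (by simp)
  obtain ⟨w, hw, hw0⟩ := Submodule.exists_mem_ne_zero_of_ne_bot h
  rw [LinearMap.ker_prod] at hw
  exact ⟨w, hw0, hw.1, hw.2⟩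

end Forms

section Hermitian

variable {C : Type*} [Field C] {R : Subfield C}

theorem IsHermBlock.eq_inter {σ : C →+* C} {ε : C} {B ℓ : Set (Projectivization C (Fin 3 → C))}
    (hB : IsHermBlock R σ ε B) (hℓ : IsLine C ℓ) (h : B ⊆ ℓ) : B = hermSet R σ ε ∩ ℓ := by
  obtain ⟨m, hm, ⟨P, hP, Q, hQ, hPQ⟩, rfl⟩ := hB
  rw [hm.eq_of_mem hℓ hPQ hP.2 hQ.2 (h hP) (h hQ)]

/-- The `R`-quadratic form whose zeros are the points of the unital, for `φ` a functional with
kernel `εR`. -/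
def hermForm (φ : C →ₗ[R] R) (σ : C →+* C) (v : Fin 3 → C) : R :=
  φ (σ (v 0) * v 1 + σ (v 2) * v 2)

/-- The linear form defining the tangent line at `p`. -/
def tangentForm (σ : C →+* C) (k : C) (p : Fin 3 → C) : (Fin 3 → C) →ₗ[C] C :=
  σ (p 0) • LinearMap.proj 1 + (k * σ (p 1)) • LinearMap.proj 0 +
    ((1 + k) * σ (p 2)) • LinearMap.proj 2

theorem map_coe_mul (φ : C →ₗ[R] R) (r : R) (x : C) : φ (r * x) = r * φ x :=
  φ.map_smul r x

theorem exists_functional {ε : C} (hrank : finrank R C = 2) (hε : ε ∉ R) :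
    ∃ φ : C →ₗ[R] R, φ 1 = 1 ∧ φ ε = 0 ∧ ∀ x, ∃ r : R, x = φ x + ε * r := by
  have hli : LinearIndependent R ![(1 : C), ε] := by
    rw [LinearIndependent.pair_iff' one_ne_zero]
    rintro a rfl
    exact hε (by simp [Algebra.smul_def, Subfield.algebraMap_ofSubfield])
  let b := basisOfLinearIndependentOfCardEqFinrank hli (by simp [hrank])
  have h0 : b 0 = 1 := by simp [b]
  have h1 : b 1 = ε := by simp [b]
  refine ⟨b.coord 0, ?_, ?_, fun x => ⟨b.coord 1 x, ?_⟩⟩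
  · rw [← h0]; simp
  · rw [← h1]; simp
  · have := b.sum_repr x
    rw [Fin.sum_univ_two, h0, h1] at this
    conv_lhs => rw [← this]
    simp [Subfield.smul_def, mul_comm]

variable {φ : C →ₗ[R] R} {σ : C →+* C} {ε : C}

theorem hermForm_smul {v : Fin 3 → C} {c : C} {n : R} (hn : σ c * c = n) :
    hermForm φ σ (c • v) = n * hermForm φ σ v := by
  simp only [hermForm, Pi.smul_apply, smul_eq_mul, map_mul]
  rw [← map_coe_mul, ← hn]
  congr 1
  ring

theorem hermForm_add_smul (hσσ : ∀ x, σ (σ x) = x) {k : C} (hk : ∀ x, φ (σ x) = φ (k * x))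
    (u p : Fin 3 → C) (c : C) :
    hermForm φ σ (u + c • p) =
      hermForm φ σ u + hermForm φ σ (c • p) + φ (σ c * tangentForm σ k p u) := by
  have h (a b : C) : φ (σ a * b) = φ (k * (σ b * a)) := by
    rw [← hk, map_mul σ, hσσ, mul_comm]
  have h1 := h (u 0) (c * p 1)
  have h2 := h (u 2) (c * p 2)
  rw [map_mul σ] at h1 h2
  have e : σ ((u + c • p) 0) * (u + c • p) 1 + σ ((u + c • p) 2) * (u + c • p) 2 =
      (σ (u 0) * u 1 + σ (u 2) * u 2) +
      (σ ((c • p) 0) * (c • p) 1 + σ ((c • p) 2) * (c • p) 2) +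
      (σ (u 0) * (c * p 1) + σ (u 2) * (c * p 2) + σ c * σ (p 0) * u 1 +
        σ c * σ (p 2) * u 2) := by
    simp; ring
  simp only [hermForm]
  rw [e, map_add, map_add φ (σ (u 0) * u 1 + σ (u 2) * u 2)]
  congr 1
  rw [map_add, map_add, map_add, h1, h2, ← map_add, ← map_add, ← map_add]
  congr 1
  simp [tangentForm]
  ring

theorem exists_hermForm_add_smul (hσR : ∀ r : R, σ r = r) (u e : Fin 3 → C) :
    ∃ β : R, ∀ r : R, hermForm φ σ (u + (r : C) • e) =
      hermForm φ σ u + r * β + r * (r * hermForm φ σ e) := by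
  refine ⟨φ (σ (u 0) * e 1 + σ (e 0) * u 1 + σ (u 2) * e 2 + σ (e 2) * u 2), fun r => ?_⟩
  simp only [hermForm]
  rw [← map_coe_mul, ← map_coe_mul, ← map_coe_mul, ← map_add, ← map_add]
  congr 1
  simp [hσR]
  ring

theorem tangentForm_ne_zero (hφ1 : φ 1 = 1) (hnorm : ∀ c, ∃ n : R, σ c * c = n)
    {k : C} (hk0 : k ≠ 0) {p : Fin 3 → C} (hp0 : p ≠ 0) (hp : hermForm φ σ p = 0) :
    tangentForm σ k p ≠ 0 := by
  intro h
  have h0 : p 0 = 0 := by simpa [tangentForm] using LinearMap.congr_fun h (Pi.single 1 1)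
  have h1 : p 1 = 0 := by simpa [tangentForm, hk0] using LinearMap.congr_fun h (Pi.single 0 1)
  obtain ⟨n, hn⟩ := hnorm (p 2)
  have h2 : p 2 = 0 := by
    have h3 : φ ((n : C) * 1) = 0 := by simpa [hermForm, h0, hn] using hp
    rw [map_coe_mul, hφ1, mul_one] at h3
    simpa [h3] using hn
  exact hp0 (by ext i; fin_cases i <;> simp [h0, h1, h2])

/-- A form whose kernel meets the quadric only in `p` is proportional to the tangent form. -/
theorem exists_tangentForm_eq (hφ1 : φ 1 = 1) (hσσ : ∀ x, σ (σ x) = x)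
    (hnorm : ∀ c, ∃ n : R, σ c * c = n) {k : C} (hk0 : k ≠ 0) (hk : ∀ x, φ (σ x) = φ (k * x))
    {p : Fin 3 → C} (hp0 : p ≠ 0) (hp : hermForm φ σ p = 0) {τ : (Fin 3 → C) →ₗ[C] C}
    (hτp : τ p = 0) (hτu : ∀ u, τ u = 0 → hermForm φ σ u = 0 → ∃ c : C, u = c • p) :
    ∃ a : C, a ≠ 0 ∧ ∀ u, tangentForm σ k p u = a * τ u := by
  have hcp (c : C) : hermForm φ σ (c • p) = 0 := by
    obtain ⟨n, hn⟩ := hnorm c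
    rw [hermForm_smul hn, hp, mul_zero]
  have hGp : tangentForm σ k p p = 0 := by
    by_contra hG
    have h := hermForm_add_smul hσσ hk p p (σ (tangentForm σ k p p)⁻¹)
    rw [hσσ, inv_mul_cancel₀ hG, hφ1, hp, hcp, ← add_zero p, add_assoc, zero_add] at h
    nth_rewrite 1 [← one_smul C p] at h
    rw [add_zero, ← add_smul, hcp] at h
    simp at h
  have hker (u : Fin 3 → C) (hu : τ u = 0) : tangentForm σ k p u = 0 := by
    by_contra hG
    have hφl : φ (-(hermForm φ σ u : C)) = -hermForm φ σ u := by
      have := map_coe_mul φ (-hermForm φ σ u) 1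
      simpa [hφ1] using this
    have h := hermForm_add_smul hσσ hk u p (σ (-(hermForm φ σ u : C) / tangentForm σ k p u))
    rw [hσσ, div_mul_cancel₀ _ hG, hφl, hcp, add_zero, add_neg_cancel] at h
    obtain ⟨c, hc⟩ := hτu _ (by simp [hu, hτp]) h
    rw [eq_sub_of_add_eq hc, ← sub_smul, map_smul, hGp, smul_zero] at hG
    exact hG rfl
  have hG0 := tangentForm_ne_zero hφ1 hnorm hk0 hp0 hp
  obtain ⟨v, hv⟩ : ∃ v, tangentForm σ k p v ≠ 0 := by
    by_contra! h
    exact hG0 (LinearMap.ext h)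
  have hτv : τ v ≠ 0 := fun h => hv (hker v h)
  refine ⟨tangentForm σ k p v / τ v, div_ne_zero hv hτv, fun u => ?_⟩
  have h := hker (u - (τ u / τ v) • v) (by simp [hτv])
  rw [map_sub, map_smul, smul_eq_mul, sub_eq_zero] at h
  rw [h]
  ring

theorem exists_normalized_point (hnorm : ∀ c, ∃ n : R, σ c * c = n) {p : Fin 3 → C}
    {τ : (Fin 3 → C) →ₗ[C] C} (hτp : τ p = 0)
    (hadd : ∀ u (c : C), hermForm φ σ (u + c • p) = hermForm φ σ u + φ (σ c * τ u))
    (hτu : ∀ u, τ u = 0 → hermForm φ σ u = 0 → ∃ c : C, u = c • p)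
    {f f' g : (Fin 3 → C) →ₗ[C] C} (hfp : f p ≠ 0) (hfp' : f' p ≠ 0) (hg : g ≠ 0) (hgp : g p = 0)
    {y y' : Fin 3 → C} (hy0 : y ≠ 0) (hy0' : y' ≠ 0) (hgy : g y = 0) (hgy' : g y' = 0)
    (hfy : f y = 0) (hfy' : f' y' = 0) (hy : hermForm φ σ y = 0) (hy' : hermForm φ σ y' = 0) :
    ∃ (x : Fin 3 → C) (l : C), g x = 0 ∧ f x = 0 ∧ τ x = 1 ∧ hermForm φ σ x = 0 ∧
      φ (σ l) = 0 ∧ f' x + l * f' p = 0 := by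
  have hp0 : p ≠ 0 := by
    rintro rfl
    simp at hfp
  have hτy : τ y ≠ 0 := by
    intro h
    obtain ⟨c, rfl⟩ := hτu y h hy
    have hc : c = 0 := by simpa [hfp] using hfy
    exact hy0 (by simp [hc])
  have hscale (c : C) {v : Fin 3 → C} (hv : hermForm φ σ v = 0) : hermForm φ σ (c • v) = 0 := by
    obtain ⟨n, hn⟩ := hnorm c
    rw [hermForm_smul hn, hv, mul_zero]
  have hpy : LinearIndependent C ![p, y] := by
    rw [LinearIndependent.pair_iff' hp0]
    rintro a rfl
    simp [hτp] at hτy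
  obtain ⟨a, b, rfl⟩ := exists_eq_smul_add_smul_of_apply_eq_zero hg hgp hgy hgy' hpy
  have hb : b ≠ 0 := by
    rintro rfl
    have ha : a = 0 := by simpa [hfp'] using hfy'
    exact hy0' (by simp [ha])
  have hx : hermForm φ σ ((τ y)⁻¹ • y) = 0 := hscale _ hy
  have hτx : τ ((τ y)⁻¹ • y) = 1 := by simp [hτy]
  have hx' := hscale (b * τ y)⁻¹ hy'
  have hsplit : (b * τ y)⁻¹ • (a • p + b • y) = (τ y)⁻¹ • y + (a / (b * τ y)) • p := by
    ext i
    simp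
    field_simp
    ring
  refine ⟨(τ y)⁻¹ • y, a / (b * τ y), by simp [hgy], by simp [hfy], hτx, hx, ?_, ?_⟩
  · rw [hsplit, hadd, hx, hτx, mul_one, zero_add] at hx'
    exact hx'
  · have h := congrArg f' hsplit
    rw [map_smul, hfy', smul_zero, map_add, map_smul f' (a / _), smul_eq_mul] at h
    exact h.symm

theorem injective_vecCons_three {α : Type*} {a b c : α} (hab : a ≠ b) (hac : a ≠ c)
    (hbc : b ≠ c) : Function.Injective ![a, b, c] := by
  intro i j h
  fin_cases i <;> fin_cases j <;> simp_all [eq_comm]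

theorem quadratic_not_three_roots {K : Type*} [Field K] {q b s : K} {r : Fin 3 → K}
    (hr : Function.Injective r) (hs : s ≠ 0) (h : ∀ i, q + r i * b + r i * (r i * s) = 0) :
    False := by
  have h01 : r 0 - r 1 ≠ 0 := sub_ne_zero.2 (hr.ne (by decide))
  have h02 : r 0 - r 2 ≠ 0 := sub_ne_zero.2 (hr.ne (by decide))
  have h12 : r 1 - r 2 ≠ 0 := sub_ne_zero.2 (hr.ne (by decide))
  have : (r 0 - r 1) * ((r 0 - r 2) * ((r 1 - r 2) * s)) = 0 := by
    linear_combination (r 1 - r 2) * h 0 - (r 0 - r 2) * h 1 + (r 0 - r 1) * h 2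
  simp_all

theorem not_injective_of_common_zero (hσR : ∀ r : R, σ r = r) {ε' : C}
    (hφσ : ∀ x, φ (σ x) = 0 → ∃ r : R, x = ε' * r) {p : Fin 3 → C}
    {τ : (Fin 3 → C) →ₗ[C] C} (hτu : ∀ u, τ u = 0 → hermForm φ σ u = 0 → ∃ c : C, u = c • p)
    {f f' : (Fin 3 → C) →ₗ[C] C} (hf : f ≠ 0) (hfp : f p ≠ 0)
    {y w : Fin 3 → C} (hfy : f y = 0) (hfy' : f' y ≠ 0)
    (hfw : f w = 0) (hfw' : f' w = 0) (hτw : τ w = 1)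
    {x : Fin 3 → Fin 3 → C} {l : Fin 3 → C} (hfx : ∀ i, f (x i) = 0) (hτx : ∀ i, τ (x i) = 1)
    (hx : ∀ i, hermForm φ σ (x i) = 0) (hl : ∀ i, φ (σ (l i)) = 0)
    (hxl : ∀ i, f' (x i) + l i * f' p = 0) : ¬ Function.Injective x := by
  intro hinj
  obtain ⟨e, he⟩ : ∃ e, e = x 1 - x 0 := ⟨_, rfl⟩
  have he0 : e ≠ 0 := he ▸ sub_ne_zero.2 (hinj.ne (by decide))
  have hfe : f e = 0 := by simp [he, hfx]
  have hτe : τ e = 0 := by simp [he, hτx]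
  have hwe : LinearIndependent C ![w, e] := by
    rw [LinearIndependent.pair_iff]
    intro a b h
    have ha : a = 0 := by simpa [hτw, hτe] using congrArg τ h
    exact ⟨ha, by simpa [ha, he0] using h⟩
  have hfe' : f' e ≠ 0 := by
    intro h
    exact hfy' (apply_eq_zero_of_apply_eq_zero hf hwe hfw hfe hfw' h hfy)
  choose r hr using fun i => hφσ _ (hl i)
  obtain ⟨E, hE⟩ : ∃ E, E = (-(ε' * f' p) / f' e) • e := ⟨_, rfl⟩
  have hxE (i) : x i = w + (r i : C) • E := by
    obtain ⟨a, b, hab⟩ := exists_eq_smul_add_smul_of_apply_eq_zero hf hfw hfe (hfx i) hwe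
    have ha : a = 1 := by simpa [hab, hτw, hτe] using hτx i
    have hb := hxl i
    rw [hr i, hab, map_add, map_smul, map_smul, hfw', smul_zero, zero_add, smul_eq_mul] at hb
    rw [hab, ha, one_smul, hE, smul_smul]
    congr 2
    field_simp
    linear_combination hb
  have hrinj : Function.Injective r := fun i j h => hinj (by rw [hxE, hxE, h])
  have hQE : hermForm φ σ E ≠ 0 := by
    intro h
    obtain ⟨c, hc⟩ := hτu E (by simp [hE, hτe]) h
    have hfE : f E = 0 := by simp [hE, hfe]
    have hc0 : c = 0 := by simpa [hc, hfp] using hfE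
    have h01 : x 0 = x 1 := by rw [hxE, hxE, hc, hc0]; simp
    exact absurd (hinj h01) (by decide)
  obtain ⟨β, hβ⟩ := exists_hermForm_add_smul (φ := φ) hσR w E
  exact quadratic_not_three_roots hrinj hQE fun i => by rw [← hβ, ← hxE, hx]

theorem mem_hermSet_iff (hnorm : ∀ c, ∃ n : R, σ c * c = n)
    (hφ : ∀ x, φ x = 0 ↔ ∃ r ∈ R, x = ε * r) (P : Projectivization C (Fin 3 → C)) :
    P ∈ hermSet R σ ε ↔ hermForm φ σ P.rep = 0 := by
  constructor
  · rintro ⟨v, hv, rfl, h⟩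
    obtain ⟨a, ha⟩ := Projectivization.exists_smul_eq_mk_rep C v hv
    obtain ⟨n, hn⟩ := hnorm a
    rw [← ha, Units.smul_def, hermForm_smul hn, hermForm, (hφ _).2 h, mul_zero]
  · exact fun h => ⟨P.rep, P.rep_nonzero, P.mk_rep.symm, (hφ _).1 h⟩

theorem exists_functional_of_quadratic {t d : C} (hrank : finrank R C = 2) (hε : ε ∉ R)
    (ht : t ∈ R) (hd : d ∈ R) (hmin : ε ^ 2 - t * ε + d = 0) (hσR : ∀ r : R, σ r = r)
    (hσε : σ ε = t - ε) :
    ∃ φ : C →ₗ[R] R, φ 1 = 1 ∧ (∀ x, φ x = 0 ↔ ∃ r ∈ R, x = ε * r) ∧ (∀ x, σ (σ x) = x) ∧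
      (∀ c, ∃ n : R, σ c * c = n) ∧ (∃ k : C, k ≠ 0 ∧ ∀ x, φ (σ x) = φ (k * x)) ∧
      ∀ x, φ (σ x) = 0 → ∃ r : R, x = σ ε * r := by
  obtain ⟨φ, hφ1, hφε, hφ⟩ := exists_functional hrank hε
  lift t to R using ht
  lift d to R using hd
  have hφR (a b : R) : φ (a + ε * b) = a := by
    have ha := map_coe_mul φ a 1
    have hb := map_coe_mul φ b ε
    rw [hφ1, mul_one, mul_one] at ha
    rw [map_add, mul_comm ε, ha, hb, hφε, mul_zero, add_zero]
  have hσφ (a b : R) : σ (a + ε * b) = (a + t * b : R) + ε * (-b : R) := by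
    simp only [map_add, map_mul, hσR, hσε]
    push_cast
    ring
  have hσσ (x : C) : σ (σ x) = x := by
    obtain ⟨b, hb⟩ := hφ x
    rw [hb, hσφ, hσφ]
    push_cast
    ring
  have hzero (x : C) : φ x = 0 ↔ ∃ r ∈ R, x = ε * r := by
    constructor
    · intro h
      obtain ⟨r, hr⟩ := hφ x
      exact ⟨r, r.2, by simpa [h] using hr⟩
    · rintro ⟨r, hr, rfl⟩
      simpa using hφR 0 ⟨r, hr⟩
  have hd0 : (d : C) ≠ 0 := by
    intro h
    rw [h, add_zero, pow_two, ← sub_mul, mul_eq_zero, sub_eq_zero] at hmin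
    rcases hmin with h | h
    · exact hε (h ▸ t.2)
    · exact hε (h ▸ R.zero_mem)
  refine ⟨φ, hφ1, hzero, hσσ, fun c => ?_, ⟨1 - t / d * ε, ?_, fun x => ?_⟩, fun x hx => ?_⟩
  · obtain ⟨b, hb⟩ := hφ c
    refine ⟨φ c * φ c + t * φ c * b + d * b * b, ?_⟩
    rw [hb, hσφ, hφR]
    push_cast
    linear_combination (-b * b : C) * hmin
  · intro h
    have h1 : φ ((1 : R) + ε * (-(t / d) : R)) = 1 := hφR _ _
    rw [show ((1 : R) + ε * (-(t / d) : R) : C) = 1 - t / d * ε by push_cast; ring, h,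
      map_zero] at h1
    exact zero_ne_one h1
  · obtain ⟨b, hb⟩ := hφ x
    rw [hb, hσφ, hφR]
    rw [show (1 - t / d * ε) * (φ x + ε * b : C) = (φ x + t * b : R) +
        ε * (b - t / d * φ x - t / d * b * t : R) by
      push_cast
      field_simp
      linear_combination (-(t : C) * b) * hmin, hφR]
  · obtain ⟨r, hr, h⟩ := (hzero _).1 hx
    refine ⟨⟨r, hr⟩, ?_⟩
    rw [← hσσ x, h, map_mul, ← hσR ⟨r, hr⟩]

/-- Projective form of `exists_normalized_point`, for two points on a common block through `p`. -/
theorem IsHermBlock.exists_normalized_point (hnorm : ∀ c, ∃ n : R, σ c * c = n)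
    (hφ : ∀ x, φ x = 0 ↔ ∃ r ∈ R, x = ε * r) {p : Projectivization C (Fin 3 → C)}
    {τ : (Fin 3 → C) →ₗ[C] C} (hτp : τ p.rep = 0)
    (hadd : ∀ u (c : C), hermForm φ σ (u + c • p.rep) = hermForm φ σ u + φ (σ c * τ u))
    (hτu : ∀ u, τ u = 0 → hermForm φ σ u = 0 → ∃ c : C, u = c • p.rep)
    {f f' : (Fin 3 → C) →ₗ[C] C} (hfp : f p.rep ≠ 0) (hfp' : f' p.rep ≠ 0)
    {X B B' : Set (Projectivization C (Fin 3 → C))} (hX : IsHermBlock R σ ε X) (hpX : p ∈ X)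
    (hB : B ⊆ {P | f P.rep = 0}) (hB' : B' ⊆ {P | f' P.rep = 0})
    (hBX : (B ∩ X).Nonempty) (hBX' : (B' ∩ X).Nonempty) :
    ∃ (x : Fin 3 → C) (l : C) (g : (Fin 3 → C) →ₗ[C] C), (g ≠ 0 ∧ g p.rep = 0 ∧ g x = 0 ∧
      X = hermSet R σ ε ∩ {P | g P.rep = 0}) ∧ f x = 0 ∧ τ x = 1 ∧ hermForm φ σ x = 0 ∧
      φ (σ l) = 0 ∧ f' x + l * f' p.rep = 0 := by
  obtain ⟨_, ⟨g, hg, rfl⟩, -, rfl⟩ := hX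
  obtain ⟨P, hPB, hPH, hPg⟩ := hBX
  obtain ⟨P', hPB', hPH', hPg'⟩ := hBX'
  rw [mem_hermSet_iff hnorm hφ] at hPH hPH'
  obtain ⟨x, l, hgx, h⟩ := _root_.exists_normalized_point hnorm hτp hadd hτu hfp hfp' hg hpX.2
    P.rep_nonzero P'.rep_nonzero hPg hPg' (hB hPB) (hB' hPB') hPH hPH'
  exact ⟨x, l, g, ⟨hg, hpX.2, hgx, rfl⟩, h⟩

end Hermitian

/-- Property (TAN) of the generalized hermitian unital `H(C|R)`: if three distinct
blocks through `p` all meet two disjoint blocks `B` and `B'` not through `p`, then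
the intersection point of the lines carrying `B` and `B'` lies on the tangent line
at `p`. -/
theorem intersection_of_lines_on_tangent
    {C : Type*} [Field C] (R : Subfield C) (ε t d : C) (σ : C →+* C)
    (hrank : Module.finrank R C = 2)
    (hε : ε ∉ R) (ht : t ∈ R) (hd : d ∈ R)
    (hmin : ε ^ 2 - t * ε + d = 0)
    (hσR : ∀ r ∈ R, σ r = r) (hσε : σ ε = t - ε)
    (p : Projectivization C (Fin 3 → C)) (hp : p ∈ hermSet R σ ε)
    (X Y Z : Set (Projectivization C (Fin 3 → C)))
    (hX : IsHermBlock R σ ε X) (hY : IsHermBlock R σ ε Y) (hZ : IsHermBlock R σ ε Z)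
    (hXY : X ≠ Y) (hXZ : X ≠ Z) (hYZ : Y ≠ Z)
    (hpX : p ∈ X) (hpY : p ∈ Y) (hpZ : p ∈ Z)
    (B B' : Set (Projectivization C (Fin 3 → C)))
    (hB : IsHermBlock R σ ε B) (hB' : IsHermBlock R σ ε B')
    (hpB : p ∉ B) (hpB' : p ∉ B') (hBB' : B ∩ B' = ∅)
    (hBX : (B ∩ X).Nonempty) (hBY : (B ∩ Y).Nonempty) (hBZ : (B ∩ Z).Nonempty)
    (hB'X : (B' ∩ X).Nonempty) (hB'Y : (B' ∩ Y).Nonempty) (hB'Z : (B' ∩ Z).Nonempty)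
    (ℓB ℓB' T : Set (Projectivization C (Fin 3 → C)))
    (hℓB : IsLine C ℓB) (hBsub : B ⊆ ℓB)
    (hℓB' : IsLine C ℓB') (hB'sub : B' ⊆ ℓB')
    (hT : IsLine C T) (hTtan : T ∩ hermSet R σ ε = {p}) :
    ∃ w, ℓB ∩ ℓB' = {w} ∧ w ∈ T := by
  have hσR' (r : R) : σ r = r := hσR r r.2
  obtain ⟨φ, hφ1, hφ, hσσ, hnorm, ⟨k, hk0, hk⟩, hφσ⟩ :=
    exists_functional_of_quadratic hrank hε ht hd hmin hσR' hσε
  have hBeq := hB.eq_inter hℓB hBsub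
  have hB'eq := hB'.eq_inter hℓB' hB'sub
  have hne : ℓB ≠ ℓB' := by
    rintro rfl
    obtain ⟨P, hP, -⟩ := hBX
    exact Set.notMem_empty P (hBB' ▸ ⟨hP, hB'eq ▸ hBeq ▸ hP⟩)
  have hunique {P Q} (hP : P ∈ ℓB ∩ ℓB') (hQ : Q ∈ ℓB ∩ ℓB') : P = Q := by
    by_contra h
    exact hne (hℓB.eq_of_mem hℓB' h hP.1 hQ.1 hP.2 hQ.2)
  have hpℓ : p ∉ ℓB := fun h => hpB (hBeq ▸ ⟨hp, h⟩)
  have hpℓ' : p ∉ ℓB' := fun h => hpB' (hB'eq ▸ ⟨hp, h⟩)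
  obtain ⟨f, hf, rfl⟩ := hℓB
  obtain ⟨f', hf', rfl⟩ := hℓB'
  obtain ⟨T', -, rfl⟩ := hT
  obtain ⟨w, hw0, hfw, hfw'⟩ := exists_ne_zero_apply_eq_zero f f'
  have hw : Projectivization.mk C w hw0 ∈ ({P | f P.rep = 0} ∩ {P | f' P.rep = 0} : Set _) :=
    ⟨(apply_mk_rep_eq_zero_iff f hw0).2 hfw, (apply_mk_rep_eq_zero_iff f' hw0).2 hfw'⟩
  refine ⟨_, Set.eq_singleton_iff_unique_mem.2 ⟨hw, fun Q hQ => hunique hQ hw⟩, ?_⟩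
  rw [Set.mem_ofPred_eq, apply_mk_rep_eq_zero_iff]
  by_contra hTw
  have hTp : T' p.rep = 0 := (hTtan.symm.subset rfl : p ∈ _).1
  have hpQ : hermForm φ σ p.rep = 0 := (mem_hermSet_iff hnorm hφ p).1 hp
  have hTu (u : Fin 3 → C) (hu : T' u = 0) (hQ : hermForm φ σ u = 0) :
      ∃ c : C, u = c • p.rep := by
    by_cases hu0 : u = 0
    · exact ⟨0, by simp [hu0]⟩
    obtain ⟨a, ha⟩ := Projectivization.exists_smul_eq_mk_rep C u hu0
    have hmem : Projectivization.mk C u hu0 = p := by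
      refine hTtan.subset ⟨(apply_mk_rep_eq_zero_iff T' hu0).2 hu, ?_⟩
      exact ⟨u, hu0, rfl, (hφ _).1 hQ⟩
    exact ⟨(a⁻¹ : Cˣ), by rw [← hmem, ← ha, ← Units.smul_def, inv_smul_smul]⟩
  obtain ⟨a, ha0, ha⟩ :=
    exists_tangentForm_eq hφ1 hσσ hnorm hk0 hk p.rep_nonzero hpQ hTp hTu
  set τ := tangentForm σ k p.rep
  have hτp : τ p.rep = 0 := by rw [ha, hTp, mul_zero]
  have hτw : τ w ≠ 0 := by rw [ha]; exact mul_ne_zero ha0 hTw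
  have hτu (u : Fin 3 → C) (hu : τ u = 0) : hermForm φ σ u = 0 → ∃ c : C, u = c • p.rep :=
    hTu u (by simpa [ha, ha0] using hu)
  have hadd (u : Fin 3 → C) (c : C) :
      hermForm φ σ (u + c • p.rep) = hermForm φ σ u + φ (σ c * τ u) := by
    obtain ⟨n, hn⟩ := hnorm c
    rw [hermForm_add_smul hσσ hk, hermForm_smul hn, hpQ, mul_zero, add_zero]
  obtain ⟨y, hfy, hfy'⟩ : ∃ y, f y = 0 ∧ f' y ≠ 0 := by
    by_contra! h
    obtain ⟨P, hP, Q, hQ, hPQ⟩ : B.Nontrivial := by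
      obtain ⟨_, -, h, rfl⟩ := hB
      exact h
    exact hne (IsLine.eq_of_mem ⟨f, hf, rfl⟩ ⟨f', hf', rfl⟩ hPQ (hBsub hP) (hBsub hQ)
      (h _ (hBsub hP)) (h _ (hBsub hQ)))
  have hblock (S : Fin 3 → Set (Projectivization C (Fin 3 → C))) (hS : S = ![X, Y, Z]) (i : Fin 3) :=
    IsHermBlock.exists_normalized_point (X := S i) (B := B) (B' := B') hnorm hφ hτp hadd hτu
      hpℓ hpℓ' (by subst hS; fin_cases i <;> assumption) (by subst hS; fin_cases i <;> assumption)
      hBsub hB'sub (by subst hS; fin_cases i <;> assumption)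
      (by subst hS; fin_cases i <;> assumption)
  choose x l g hg hfx hτx hx hl hxl using hblock _ rfl
  refine not_injective_of_common_zero hσR' hφσ hτu hf hpℓ hfy hfy' (w := (τ w)⁻¹ • w)
    (by simp [hfw]) (by simp [hfw']) (by simp [hτw]) hfx hτx hx hl hxl fun i j hij => ?_
  have hind : LinearIndependent C ![p.rep, x i] := by
    rw [LinearIndependent.pair_iff' p.rep_nonzero]
    intro c hc
    simpa [← hc, hτp] using hτx i
  have hSij : ![X, Y, Z] i = ![X, Y, Z] j := by
    rw [(hg i).2.2.2, (hg j).2.2.2, setOf_rep_eq_of_linearIndependent (hg i).1 (hg j).1 hind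
      (hg i).2.1 (hg i).2.2.1 (hg j).2.1 (hij ▸ (hg j).2.2.1)]
  exact injective_vecCons_three hXY hXZ hYZ hSij
end
end

section
/- If the generalized hermitian unital H(C|R) contains a subunital of order q for some integer q ≥ 2, then the extension C|R is separable, i.e. σ ≠ id. -/
noncomputable section

/-- A subunital of order `q` of `H(C|R)`: a set `U` of `q³ + 1` points of the unital
such that every block containing at least two points of `U` contains exactly
`q + 1` points of `U`. -/
def IsSubunital {C : Type*} [Field C] (R : Subfield C) (σ : C →+* C) (ε : C)
    (q : ℕ) (U : Set (Projectivization C (Fin 3 → C))) : Prop :=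
  U ⊆ hermSet R σ ε ∧ U.ncard = q ^ 3 + 1 ∧
    ∀ B, IsHermBlock R σ ε B → (B ∩ U).Nontrivial → (B ∩ U).ncard = q + 1


section Algebra

variable {C : Type*} [Field C] {R : Subfield C} {ε : C}

/-- `εR` meets `R` only in `0`. -/
lemma eq_zero_of_eq_eps_mul (hε : ε ∉ R) {a r : C} (ha : a ∈ R) (hr : r ∈ R)
    (h : a = ε * r) : a = 0 := by
  by_cases h0 : r = 0
  · simp [h, h0]
  · refine absurd ?_ hε
    have : ε = a / r := by field_simp; exact h.symm
    rw [this]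
    exact R.div_mem ha hr

/-- Two affine lines having points of the unital over the same three abscissae are parallel. -/
lemma slope_eq_of_three_common (hε : ε ∉ R) (h2 : (2 : C) = 0) (hsq : ∀ x : C, x ^ 2 ∈ R)
    {k k' b b' w₀ w₁ w₂ : C} (h01 : w₁ ≠ w₀) (h02 : w₂ ≠ w₀) (h12 : w₁ ≠ w₂)
    (h0 : ∃ r ∈ R, k * w₀ + b + w₀ ^ 2 = ε * r) (h1 : ∃ r ∈ R, k * w₁ + b + w₁ ^ 2 = ε * r)
    (h2' : ∃ r ∈ R, k * w₂ + b + w₂ ^ 2 = ε * r)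
    (h0' : ∃ r ∈ R, k' * w₀ + b' + w₀ ^ 2 = ε * r)
    (h1' : ∃ r ∈ R, k' * w₁ + b' + w₁ ^ 2 = ε * r)
    (h2'' : ∃ r ∈ R, k' * w₂ + b' + w₂ ^ 2 = ε * r) : k = k' := by
  obtain ⟨r₀, hr₀, e₀⟩ := h0
  obtain ⟨r₁, hr₁, e₁⟩ := h1
  obtain ⟨r₂, hr₂, e₂⟩ := h2'
  obtain ⟨s₀, hs₀, f₀⟩ := h0'
  obtain ⟨s₁, hs₁, f₁⟩ := h1'
  obtain ⟨s₂, hs₂, f₂⟩ := h2''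
  by_contra hk
  have hk' : k - k' ≠ 0 := sub_ne_zero.mpr hk
  have hu₂ : w₂ - w₀ ≠ 0 := sub_ne_zero.mpr h02
  have hu₁ : w₁ - w₀ ≠ 0 := sub_ne_zero.mpr h01
  set ρ₁ := r₁ - r₀ - (s₁ - s₀) with hρ₁
  set ρ₂ := r₂ - r₀ - (s₂ - s₀) with hρ₂
  have g₁ : (k - k') * (w₁ - w₀) = ε * ρ₁ := by
    rw [hρ₁]; linear_combination e₁ - e₀ - f₁ + f₀
  have g₂ : (k - k') * (w₂ - w₀) = ε * ρ₂ := by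
    rw [hρ₂]; linear_combination e₂ - e₀ - f₂ + f₀
  have hρ₂0 : ρ₂ ≠ 0 := by
    intro h
    rw [h, mul_zero] at g₂
    exact mul_ne_zero hk' hu₂ g₂
  have hρ₁R : ρ₁ ∈ R := R.sub_mem (R.sub_mem hr₁ hr₀) (R.sub_mem hs₁ hs₀)
  have hρ₂R : ρ₂ ∈ R := R.sub_mem (R.sub_mem hr₂ hr₀) (R.sub_mem hs₂ hs₀)
  obtain ⟨c, hc⟩ : ∃ c, c = ρ₁ / ρ₂ := ⟨_, rfl⟩
  have hcR : c ∈ R := hc ▸ R.div_mem hρ₁R hρ₂R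
  have hcρ : ρ₁ = c * ρ₂ := by rw [hc]; field_simp
  have hu : w₁ - w₀ = c * (w₂ - w₀) := by
    apply mul_left_cancel₀ hk'
    rw [g₁, hcρ]
    linear_combination -c * g₂
  have key : (w₁ - w₀) ^ 2 - c * (w₂ - w₀) ^ 2 = ε * (r₁ - r₀ - c * (r₂ - r₀)) := by
    linear_combination e₁ - e₀ - c * (e₂ - e₀) - k * hu
      + (w₀ ^ 2 - w₁ * w₀ - c * (w₀ ^ 2 - w₂ * w₀)) * h2
  have hz := eq_zero_of_eq_eps_mul hε
    (R.sub_mem (hsq _) (R.mul_mem hcR (hsq _)))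
    (R.sub_mem (R.sub_mem hr₁ hr₀) (R.mul_mem hcR (R.sub_mem hr₂ hr₀))) key
  have hz' : (w₁ - w₀) * (w₁ - w₂) = 0 := by
    linear_combination hz - (w₂ - w₀) * hu
  rcases mul_eq_zero.mp hz' with h | h
  · exact hu₁ h
  · exact h12 (sub_eq_zero.mp h)

open Classical in
/-- Translation lemma in affine coordinates: the affine part of a finite subunital containing
the point at infinity is closed under the vertical translations it determines. -/
lemma affine_translate_mem (hε : ε ∉ R) (h2 : (2 : C) = 0) (hsq : ∀ x : C, x ^ 2 ∈ R)
    {q : ℕ} (hq : 2 ≤ q) (A : Finset (C × C)) (hcard : A.card = q ^ 3)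
    (hH : ∀ x ∈ A, ∃ r ∈ R, x.2 + x.1 ^ 2 = ε * r)
    (hv : ∀ x ∈ A, (A.filter (fun z => z.1 = x.1)).card = q)
    (hl : ∀ x ∈ A, ∀ y ∈ A, x.1 ≠ y.1 → ∀ k b, x.2 = k * x.1 + b → y.2 = k * y.1 + b →
      (A.filter (fun z => z.2 = k * z.1 + b)).card = q + 1)
    {w₀ α₀ s w₁ α₁ : C} (hx : (w₀, α₀) ∈ A) (hy : (w₀, α₀ + s) ∈ A) (ha : (w₁, α₁) ∈ A)
    (hw : w₁ ≠ w₀) : (w₁, α₁ + s) ∈ A := by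
  obtain ⟨k, hk⟩ : ∃ k, k = (α₁ - α₀) / (w₁ - w₀) := ⟨_, rfl⟩
  obtain ⟨b, hb⟩ : ∃ b, b = α₀ - k * w₀ := ⟨_, rfl⟩
  have hwne : w₁ - w₀ ≠ 0 := sub_ne_zero.mpr hw
  have hx' : α₀ = k * w₀ + b := by rw [hb]; ring
  have ha' : α₁ = k * w₁ + b := by
    have : k * (w₁ - w₀) = α₁ - α₀ := by rw [hk]; field_simp
    rw [hb]; linear_combination -this
  set m : C × C → C := fun z => (z.2 - (α₀ + s)) / (z.1 - w₀) with hm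
  have hm_eq : ∀ z : C × C, z.1 ≠ w₀ → ∀ c, m z = c ↔ z.2 = c * z.1 + (α₀ + s - c * w₀) := by
    intro z hz c
    have : z.1 - w₀ ≠ 0 := sub_ne_zero.mpr hz
    simp only [hm]
    rw [div_eq_iff this]
    constructor <;> intro h <;> linear_combination h
  set A' := A.filter (fun z => z.1 ≠ w₀) with hA'
  have hA'card : A'.card + q = q ^ 3 := by
    have h1 := Finset.card_filter_add_card_filter_not (s := A) (fun z => z.1 = w₀)
    have h3 := hv _ hx
    simp only at h3
    rw [h3, hcard] at h1
    rw [hA', ← h1, add_comm]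
  have hfib : ∀ c ∈ A'.image m, (A'.filter (fun z => m z = c)).card = q := by
    intro c hc
    obtain ⟨z, hz, rfl⟩ := Finset.mem_image.mp hc
    obtain ⟨hzA, hz0⟩ := Finset.mem_filter.mp hz
    have h1 := hl _ hy z hzA (Ne.symm hz0) (m z) (α₀ + s - m z * w₀) (by ring)
      ((hm_eq z hz0 _).mp rfl)
    have h3 : A'.filter (fun z' => m z' = m z) =
        (A.filter (fun z' => z'.2 = m z * z'.1 + (α₀ + s - m z * w₀))).erase (w₀, α₀ + s) := by
      ext z'
      simp only [hA', Finset.mem_filter, Finset.mem_erase]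
      constructor
      · rintro ⟨⟨h4, h5⟩, h6⟩
        exact ⟨fun h => h5 (by rw [h]), h4, (hm_eq z' h5 _).mp h6⟩
      · rintro ⟨h4, h5, h6⟩
        have h7 : z'.1 ≠ w₀ := by
          intro h
          apply h4
          ext
          · exact h
          · rw [h6, h]; ring
        exact ⟨⟨h5, h7⟩, (hm_eq z' h7 _).mpr h6⟩
    rw [h3, Finset.card_erase_of_mem, h1]
    · rfl
    · rw [Finset.mem_filter]
      exact ⟨hy, by ring⟩
  have hK : (A'.image m).card + 1 = q ^ 2 := by
    have h1 : A'.card = (A'.image m).card * q := by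
      rw [Finset.card_eq_sum_card_image m A', Finset.sum_const_nat hfib]
    have h3 : ((A'.image m).card + 1) * q = q ^ 2 * q := by rw [add_mul, ← h1, one_mul, hA'card]; ring
    exact Nat.eq_of_mul_eq_mul_right (by omega) h3
  have hcount : ∀ Ω : Finset C, w₀ ∈ Ω → (∀ w ∈ Ω, ∃ z ∈ A, z.1 = w) →
      (∀ w ∈ Ω, ∃ r ∈ R, k * w + b + w ^ 2 = ε * r) →
      (Ω.card - 1) * q ≤ ((A'.image m).erase k).card + (A'.filter (fun z => m z = k)).card := by
    intro Ω h0 hΩA hΩ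
    set E := A'.filter (fun z => z.1 ∈ Ω) with hE
    have hEc : E.card = (Ω.card - 1) * q := by
      rw [Finset.card_eq_sum_card_fiberwise (f := Prod.fst) (t := Ω.erase w₀)]
      · rw [← Finset.card_erase_of_mem h0, Finset.sum_const_nat]
        intro w hw'
        obtain ⟨h4, h5⟩ := Finset.mem_erase.mp hw'
        obtain ⟨z, hz, rfl⟩ := hΩA w h5
        rw [← hv z hz]
        congr 1
        ext z'
        simp only [hE, hA', Finset.mem_filter]
        constructor
        · rintro ⟨⟨⟨h6, -⟩, -⟩, h7⟩
          exact ⟨h6, h7⟩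
        · rintro ⟨h6, h7⟩
          exact ⟨⟨⟨h6, h7 ▸ h4⟩, h7 ▸ h5⟩, h7⟩
      · intro z hz
        simp only [hE, hA', Finset.coe_filter, Finset.mem_filter, Set.mem_ofPred_eq] at hz
        simp [hz]
    rw [← hEc, ← Finset.card_filter_add_card_filter_not (s := E) (fun z => m z = k), add_comm]
    refine Nat.add_le_add ?_ (Finset.card_le_card ?_)
    · refine Finset.card_le_card_of_injOn m ?_ ?_
      · intro z hz
        simp only [hE, Finset.coe_filter, Finset.mem_filter, Set.mem_ofPred_eq] at hz
        simp only [Finset.coe_erase, Finset.coe_image, Set.mem_sdiff, Set.mem_image,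
          Set.mem_singleton_iff]
        exact ⟨⟨z, hz.1.1, rfl⟩, hz.2⟩
      · intro z hz z' hz' hzz
        simp only [hE, hA', Finset.coe_filter, Finset.mem_filter, Set.mem_ofPred_eq] at hz hz'
        obtain ⟨⟨⟨hzA, hz0⟩, hzΩ⟩, hzk⟩ := hz
        obtain ⟨⟨⟨hzA', hz0'⟩, hzΩ'⟩, -⟩ := hz'
        have e1 := (hm_eq z hz0 _).mp rfl
        have e2 := (hm_eq z' hz0' _).mp hzz.symm
        by_contra hne
        have hd : z.1 ≠ z'.1 := by
          intro h
          apply hne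
          ext
          · exact h
          · rw [e1, e2, h]
        refine hzk (slope_eq_of_three_common hε h2 hsq hz0 hz0' hd
          (b := α₀ + s - m z * w₀) ?_ ?_ ?_ (hΩ _ h0) (hΩ _ hzΩ) (hΩ _ hzΩ'))
        · obtain ⟨r, hr, h⟩ := hH _ hy
          exact ⟨r, hr, by rw [← h]; ring⟩
        · rw [← e1]; exact hH _ hzA
        · rw [← e2]; exact hH _ hzA'
    · intro z hz
      simp only [hE, Finset.mem_filter] at hz ⊢
      exact ⟨hz.1.1, hz.2⟩
  have hline_inj : ∀ k b : C,
      Set.InjOn Prod.fst ((A.filter (fun z => z.2 = k * z.1 + b) : Finset (C × C)) : Set (C × C)) := by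
    intro k b z hz z' hz' h
    simp only [Finset.coe_filter, Set.mem_ofPred_eq] at hz hz'
    ext
    · exact h
    · rw [hz.2, hz'.2, h]
  set L := (A.filter (fun z => z.2 = k * z.1 + b)).image Prod.fst with hL
  have hLc : L.card = q + 1 := by
    rw [hL, Finset.card_image_of_injOn (hline_inj k b)]
    exact hl _ hx _ ha hw.symm k b hx' ha'
  have hL0 : w₀ ∈ L := Finset.mem_image.mpr ⟨_, Finset.mem_filter.mpr ⟨hx, hx'⟩, rfl⟩
  have hL1 : w₁ ∈ L := Finset.mem_image.mpr ⟨_, Finset.mem_filter.mpr ⟨ha, ha'⟩, rfl⟩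
  have hLA : ∀ w ∈ L, ∃ z ∈ A, z.1 = w := by
    intro w hw'
    obtain ⟨z, hz, rfl⟩ := Finset.mem_image.mp hw'
    exact ⟨z, (Finset.mem_filter.mp hz).1, rfl⟩
  have hLH : ∀ w ∈ L, ∃ r ∈ R, k * w + b + w ^ 2 = ε * r := by
    intro w hw'
    obtain ⟨z, hz, rfl⟩ := Finset.mem_image.mp hw'
    obtain ⟨hz, hz'⟩ := Finset.mem_filter.mp hz
    rw [← hz']
    exact hH z hz
  have hkK : k ∈ A'.image m := by
    by_contra hkK
    have h1 := hcount L hL0 hLA hLH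
    have h3 : A'.filter (fun z => m z = k) = ∅ := by
      refine Finset.filter_eq_empty_iff.mpr ?_
      intro z hz h
      exact hkK (Finset.mem_image.mpr ⟨z, hz, h⟩)
    rw [h3, Finset.card_empty, Finset.erase_eq_of_notMem hkK, hLc, Nat.add_sub_cancel] at h1
    nlinarith
  obtain ⟨y', hy', hy'k⟩ := Finset.mem_image.mp hkK
  obtain ⟨hy'A, hy'0⟩ := Finset.mem_filter.mp hy'
  set M := (A.filter (fun z => z.2 = k * z.1 + (b + s))).image Prod.fst with hM
  have hyk : α₀ + s = k * w₀ + (b + s) := by rw [hb]; ring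
  have hMc : M.card = q + 1 := by
    rw [hM, Finset.card_image_of_injOn (hline_inj k (b + s))]
    refine hl _ hy _ hy'A (Ne.symm hy'0) k (b + s) hyk ?_
    rw [(hm_eq y' hy'0 k).mp hy'k, hb]; ring
  have hMA : ∀ w ∈ M, ∃ z ∈ A, z.1 = w := by
    intro w hw'
    obtain ⟨z, hz, rfl⟩ := Finset.mem_image.mp hw'
    exact ⟨z, (Finset.mem_filter.mp hz).1, rfl⟩
  have hMH : ∀ w ∈ M, ∃ r ∈ R, k * w + b + w ^ 2 = ε * r := by
    intro w hw'
    obtain ⟨z, hz, rfl⟩ := Finset.mem_image.mp hw'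
    obtain ⟨hz, hz'⟩ := Finset.mem_filter.mp hz
    obtain ⟨r, hr, h⟩ := hH z hz
    obtain ⟨r₀, hr₀, h₀⟩ := hH _ hx
    obtain ⟨r₁, hr₁, h₁⟩ := hH _ hy
    refine ⟨r + r₀ - r₁, R.sub_mem (R.add_mem hr hr₀) hr₁, ?_⟩
    simp only at h₀ h₁
    linear_combination h + h₀ - h₁ - hz'
  have hU : (L ∪ M).card ≤ L.card := by
    have h1 := hcount (L ∪ M) (Finset.mem_union_left _ hL0)
      (fun w hw' => (Finset.mem_union.mp hw').elim (hLA w) (hMA w))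
      (fun w hw' => (Finset.mem_union.mp hw').elim (hLH w) (hMH w))
    rw [hfib k hkK] at h1
    have h3 := Finset.card_erase_add_one hkK
    rw [hLc]
    by_contra hcon
    have h4 : q + 1 ≤ (L ∪ M).card - 1 := by omega
    have h5 := Nat.mul_le_mul_right q h4
    nlinarith
  have hLU : L = L ∪ M := Finset.eq_of_subset_of_card_le Finset.subset_union_left hU
  have hMU : M = L ∪ M :=
    Finset.eq_of_subset_of_card_le Finset.subset_union_right (by rw [hMc, ← hLc]; exact hU)
  have hw1M : w₁ ∈ M := by rw [hMU, ← hLU]; exact hL1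
  obtain ⟨z, hz, hzw⟩ := Finset.mem_image.mp hw1M
  obtain ⟨hzA, hz⟩ := Finset.mem_filter.mp hz
  have : z = (w₁, α₁ + s) := by
    ext
    · exact hzw
    · rw [hz, hzw, ha']; ring
  exact this ▸ hzA

end Algebra

section Coordinates

variable {C : Type*} [Field C]

/-- If a finite subset of a field of characteristic `2` is closed under `x ↦ x + x²`,
then its elements are squares. -/
lemma exists_sq_of_finite_artinSchreier (h2 : (2 : C) = 0) {T : Set C} (hT : T.Finite)
    (hcl : ∀ x ∈ T, x + x ^ 2 ∈ T) {x : C} (hx : x ∈ T) : ∃ c, x = c ^ 2 := by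
  have : CharP C 2 := CharTwo.of_one_ne_zero_of_two_eq_zero one_ne_zero h2
  set f : C → C := fun y => y + y ^ 2 with hf
  have hit : ∀ k : ℕ, ∀ y, f^[2 ^ k] y = y + y ^ (2 ^ (2 ^ k)) := by
    intro k
    induction k with
    | zero => intro y; simp [hf]
    | succ k ih =>
      intro y
      rw [pow_succ, mul_two, Function.iterate_add_apply, ih, ih, add_pow_char_pow, ← pow_mul,
        ← pow_add]
      linear_combination y ^ 2 ^ 2 ^ k * h2
  have hmem : ∀ n : ℕ, f^[n] x ∈ T := by
    intro n
    induction n with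
    | zero => exact hx
    | succ n ih => rw [Function.iterate_succ_apply']; exact hcl _ ih
  have hninj : ¬ Function.Injective (fun k : ℕ => f^[2 ^ k] x) := fun h =>
    Set.infinite_of_injective_forall_mem h (fun k => hmem (2 ^ k)) hT
  have hlt : ∃ k l : ℕ, k < l ∧ f^[2 ^ k] x = f^[2 ^ l] x := by
    simp only [Function.Injective, not_forall] at hninj
    obtain ⟨k, l, h, hne⟩ := hninj
    rcases lt_or_gt_of_ne hne with h' | h'
    · exact ⟨k, l, h', h⟩
    · exact ⟨l, k, h', h.symm⟩
  obtain ⟨k, l, hkl, h⟩ := hlt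
  rw [hit, hit] at h
  obtain ⟨M, hM⟩ : ∃ M, 2 ^ l = 2 ^ k + (M + 1) :=
    ⟨2 ^ l - 2 ^ k - 1, by have := Nat.pow_lt_pow_right (a := 2) (by norm_num) hkl; omega⟩
  have h' := add_left_cancel h
  rw [hM, add_comm (2 ^ k), pow_add 2 (M + 1), pow_mul] at h'
  have h3 : x = x ^ 2 ^ (M + 1) := iterateFrobenius_inj C 2 (2 ^ k) h'
  refine ⟨x ^ 2 ^ M, ?_⟩
  rw [← pow_mul, ← pow_succ]
  exact h3

/-- The alternating form obtained by polarizing `XY + Z²` in characteristic `2`. -/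
def polarForm (u v : Fin 3 → C) : C := u 0 * v 1 + u 1 * v 0

/-- The vector with coordinates `(w, α)` in the affine plane with frame `p` (vertical
direction), `o` (origin), `(0,0,1)` (horizontal direction). -/
def framePoint (p o : Fin 3 → C) (x : C × C) : Fin 3 → C :=
  o + x.2 • p + x.1 • ![0, 0, 1]

/-- The vector `v` represents a point of `U`. -/
def Represents (U : Set (Projectivization C (Fin 3 → C))) (v : Fin 3 → C) : Prop :=
  ∃ hv : v ≠ 0, Projectivization.mk C v hv ∈ U

/-- The horizontal frame coordinate of a vector. -/
def horizCoord (p o v : Fin 3 → C) : C := v 2 - polarForm p v * o 2 - polarForm o v * p 2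

/-- The linear form with coefficients `a`, `b`, `c` with respect to the dual of a frame. -/
def frameForm (p o : Fin 3 → C) (a b c : C) : (Fin 3 → C) →ₗ[C] C where
  toFun v := a * polarForm o v + b * horizCoord p o v + c * polarForm p v
  map_add' u v := by simp only [horizCoord, polarForm, Pi.add_apply]; ring
  map_smul' r v := by
    simp only [horizCoord, polarForm, Pi.smul_apply, smul_eq_mul, RingHom.id_apply]; ring

lemma represents_smul {U : Set (Projectivization C (Fin 3 → C))} {v : Fin 3 → C} {c : C}
    (hc : c ≠ 0) (h : Represents U v) : Represents U (c • v) := by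
  obtain ⟨hv, h⟩ := h
  refine ⟨smul_ne_zero hc hv, ?_⟩
  rwa [(Projectivization.mk_eq_mk_iff' C _ _ (smul_ne_zero hc hv) hv).mpr ⟨c, rfl⟩]

lemma represents_rep {U : Set (Projectivization C (Fin 3 → C))}
    {P : Projectivization C (Fin 3 → C)} (h : P ∈ U) : Represents U P.rep :=
  ⟨P.rep_nonzero, by rwa [Projectivization.mk_rep]⟩

lemma form_rep_mk (f : (Fin 3 → C) →ₗ[C] C) (v : Fin 3 → C) (hv : v ≠ 0) :
    f (Projectivization.mk C v hv).rep = 0 ↔ f v = 0 := by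
  obtain ⟨a, ha⟩ := Projectivization.exists_smul_eq_mk_rep C v hv
  rw [← ha]
  simp [Units.smul_def]

lemma polarForm_comm (u v : Fin 3 → C) : polarForm u v = polarForm v u := by
  simp only [polarForm]; ring

section Frame

variable {p o : Fin 3 → C}

lemma polarForm_framePoint (h2 : (2 : C) = 0) (hpo : polarForm p o = 1) (x : C × C) :
    polarForm p (framePoint p o x) = 1 := by
  simp only [polarForm, framePoint, Pi.add_apply, Pi.smul_apply, smul_eq_mul,
    Matrix.cons_val_zero, Matrix.cons_val_one] at hpo ⊢
  linear_combination hpo + x.2 * p 0 * p 1 * h2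

lemma polarForm_origin_framePoint (h2 : (2 : C) = 0) (hpo : polarForm p o = 1) (x : C × C) :
    polarForm o (framePoint p o x) = x.2 := by
  simp only [polarForm, framePoint, Pi.add_apply, Pi.smul_apply, smul_eq_mul,
    Matrix.cons_val_zero, Matrix.cons_val_one] at hpo ⊢
  linear_combination x.2 * hpo + o 0 * o 1 * h2

lemma horizCoord_framePoint (h2 : (2 : C) = 0) (hpo : polarForm p o = 1) (x : C × C) :
    horizCoord p o (framePoint p o x) = x.1 := by
  rw [horizCoord, polarForm_framePoint h2 hpo, polarForm_origin_framePoint h2 hpo]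
  simp only [framePoint, Pi.add_apply, Pi.smul_apply, smul_eq_mul, Matrix.cons_val]
  ring

lemma framePoint_ne_zero (h2 : (2 : C) = 0) (hpo : polarForm p o = 1) (x : C × C) :
    framePoint p o x ≠ 0 := by
  intro h
  have := polarForm_framePoint h2 hpo x
  simp [h, polarForm] at this

lemma eq_framePoint (h2 : (2 : C) = 0) (hpo : polarForm p o = 1) {v : Fin 3 → C}
    (hv : polarForm p v = 1) : v = framePoint p o (horizCoord p o v, polarForm o v) := by
  simp only [framePoint, horizCoord, hv]
  simp only [polarForm] at hpo hv ⊢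
  ext i
  fin_cases i
  · simp only [Fin.zero_eta, Pi.add_apply, Pi.smul_apply, smul_eq_mul, Matrix.cons_val_zero]
    linear_combination o 0 * hv - v 0 * hpo + (- o 0 * p 0 * v 1) * h2
  · simp only [Fin.mk_one, Pi.add_apply, Pi.smul_apply, smul_eq_mul, Matrix.cons_val_one,
      Matrix.cons_val_zero]
    linear_combination o 1 * hv - v 1 * hpo + (- o 1 * p 1 * v 0) * h2
  · simp

lemma frameForm_framePoint (h2 : (2 : C) = 0) (hpo : polarForm p o = 1) (a b c : C)
    (x : C × C) : frameForm p o a b c (framePoint p o x) = a * x.2 + b * x.1 + c := by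
  change a * polarForm o _ + b * horizCoord p o _ + c * polarForm p _ = _
  rw [polarForm_framePoint h2 hpo, polarForm_origin_framePoint h2 hpo,
    horizCoord_framePoint h2 hpo, mul_one]

lemma frameForm_vertical (h2 : (2 : C) = 0) (hpo : polarForm p o = 1) (a b c : C) :
    frameForm p o a b c p = a := by
  change a * polarForm o p + b * horizCoord p o p + c * polarForm p p = _
  have h1 : polarForm p p = 0 := by
    simp only [polarForm]; linear_combination p 0 * p 1 * h2
  rw [horizCoord, h1, polarForm_comm o p, hpo]
  ring

lemma frameForm_horizontal (a b c : C) : frameForm p o a b c ![0, 0, 1] = b := by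
  change a * polarForm o _ + b * horizCoord p o _ + c * polarForm p _ = _
  simp [horizCoord, polarForm]

lemma framePoint_mk_injective (h2 : (2 : C) = 0) (hpo : polarForm p o = 1) :
    Function.Injective (fun x : C × C =>
      Projectivization.mk C (framePoint p o x) (framePoint_ne_zero h2 hpo x)) := by
  intro x y h
  obtain ⟨c, hc⟩ := (Projectivization.mk_eq_mk_iff' C _ _ _ _).mp h
  have h1 := polarForm_framePoint h2 hpo x
  have h3 : polarForm p (c • framePoint p o y) = c * polarForm p (framePoint p o y) := by
    simp only [polarForm, Pi.smul_apply, smul_eq_mul]; ring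
  rw [← hc, h3, polarForm_framePoint h2 hpo y, mul_one] at h1
  rw [h1, one_smul] at hc
  ext
  · rw [← horizCoord_framePoint h2 hpo x, ← hc, horizCoord_framePoint h2 hpo y]
  · rw [← polarForm_origin_framePoint h2 hpo x, ← hc, polarForm_origin_framePoint h2 hpo y]

end Frame

end Coordinates

section Inseparable

variable {C : Type*} [Field C] {R : Subfield C} {ε : C}
  {q : ℕ} {U : Set (Projectivization C (Fin 3 → C))} {p o : Fin 3 → C}

lemma form_mem_of_represents (hsq : ∀ x : C, x ^ 2 ∈ R)
    (hU : U ⊆ hermSet R (RingHom.id C) ε) {v : Fin 3 → C} (h : Represents U v) :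
    ∃ r ∈ R, v 0 * v 1 + v 2 ^ 2 = ε * r := by
  obtain ⟨hv, h⟩ := h
  obtain ⟨u, hu, huv, r, hr, e⟩ := hU h
  obtain ⟨c, rfl⟩ := (Projectivization.mk_eq_mk_iff' C _ _ _ _).mp huv
  refine ⟨c ^ 2 * r, R.mul_mem (hsq c) hr, ?_⟩
  simp only [RingHom.id_apply] at e
  simp only [Pi.smul_apply, smul_eq_mul]
  linear_combination c ^ 2 * e

/-- Every line through the nucleus `[0,0,1]` meets the unital in at most one point. -/
lemma polarForm_ne_zero (hε : ε ∉ R) (h2 : (2 : C) = 0) (hsq : ∀ x : C, x ^ 2 ∈ R)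
    (hU : U ⊆ hermSet R (RingHom.id C) ε) {u v : Fin 3 → C} (hu : u ≠ 0) (hv : v ≠ 0)
    (hmu : Projectivization.mk C u hu ∈ U) (hmv : Projectivization.mk C v hv ∈ U)
    (hne : Projectivization.mk C u hu ≠ Projectivization.mk C v hv) : polarForm u v ≠ 0 := by
  intro h
  apply hne
  obtain ⟨r, hr, e⟩ := form_mem_of_represents hsq hU ⟨hu, hmu⟩
  obtain ⟨s, hs, e'⟩ := form_mem_of_represents hsq hU ⟨hv, hmv⟩
  simp only [polarForm] at h
  have hzero : ∀ (z : C) (r : C), r ∈ R → z ^ 2 = ε * r → z = 0 := fun z r hr hz =>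
    pow_eq_zero_iff two_ne_zero |>.mp (eq_zero_of_eq_eps_mul hε (hsq z) hr hz)
  have hu01 : u 0 ≠ 0 ∨ u 1 ≠ 0 := by
    by_contra! hcon
    apply hu
    have : u 2 = 0 := hzero _ r hr (by rw [← e, hcon.1]; ring)
    ext i
    fin_cases i <;> simp [hcon.1, hcon.2, this]
  obtain ⟨c, hc0, hc1⟩ : ∃ c, v 0 = c * u 0 ∧ v 1 = c * u 1 := by
    rcases hu01 with h0 | h0
    · refine ⟨v 0 / u 0, by field_simp, ?_⟩
      field_simp
      linear_combination h - u 1 * v 0 * h2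
    · refine ⟨v 1 / u 1, ?_, by field_simp⟩
      field_simp
      linear_combination h - u 0 * v 1 * h2
  have hc2 : v 2 - c * u 2 = 0 := by
    refine hzero _ (s - c ^ 2 * r) (R.sub_mem hs (R.mul_mem (hsq c) hr)) ?_
    rw [hc0, hc1] at e'
    linear_combination e' - c ^ 2 * e + (c ^ 2 * u 2 ^ 2 - c * v 2 * u 2) * h2
  symm
  refine (Projectivization.mk_eq_mk_iff' C _ _ _ _).mpr ⟨c, ?_⟩
  ext i
  fin_cases i
  · simp [hc0]
  · simp [hc1]
  · simpa using (sub_eq_zero.mp hc2).symm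

lemma exists_eq_framePoint (hε : ε ∉ R) (h2 : (2 : C) = 0) (hsq : ∀ x : C, x ^ 2 ∈ R)
    (hU : U ⊆ hermSet R (RingHom.id C) ε) (hpo : polarForm p o = 1) (hp : p ≠ 0)
    (hpU : Projectivization.mk C p hp ∈ U) {X : Projectivization C (Fin 3 → C)} (hX : X ∈ U)
    (hne : X ≠ Projectivization.mk C p hp) : ∃ x : C × C,
      Projectivization.mk C (framePoint p o x) (framePoint_ne_zero h2 hpo x) = X := by
  have h1 : polarForm p X.rep ≠ 0 :=
    polarForm_ne_zero hε h2 hsq hU hp X.rep_nonzero hpU (by rwa [Projectivization.mk_rep])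
      (by rw [Projectivization.mk_rep]; exact hne.symm)
  have h3 : polarForm p ((polarForm p X.rep)⁻¹ • X.rep) = 1 := by
    rw [← inv_mul_cancel₀ h1]
    simp only [polarForm, Pi.smul_apply, smul_eq_mul]; ring
  obtain ⟨v, hv⟩ : ∃ v, v = (polarForm p X.rep)⁻¹ • X.rep := ⟨_, rfl⟩
  rw [← hv] at h3
  refine ⟨(horizCoord p o v, polarForm o v), ?_⟩
  conv_rhs => rw [← X.mk_rep]
  exact (Projectivization.mk_eq_mk_iff' C _ _ _ _).mpr
    ⟨(polarForm p X.rep)⁻¹, hv.symm.trans (eq_framePoint h2 hpo h3)⟩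

lemma IsSubunital.line_ncard {σ : C →+* C} (hU : IsSubunital R σ ε q U)
    {f : (Fin 3 → C) →ₗ[C] C} (hf : f ≠ 0) {P Q : Projectivization C (Fin 3 → C)}
    (hP : P ∈ U) (hQ : Q ∈ U) (hPQ : P ≠ Q) (hfP : f P.rep = 0) (hfQ : f Q.rep = 0) :
    {X | X ∈ U ∧ f X.rep = 0}.ncard = q + 1 := by
  obtain ⟨hH, -, hB⟩ := hU
  have h1 := hB (hermSet R σ ε ∩ {P | f P.rep = 0})
    ⟨_, ⟨f, hf, rfl⟩, ⟨P, ⟨hH hP, hfP⟩, Q, ⟨hH hQ, hfQ⟩, hPQ⟩, rfl⟩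
    ⟨P, ⟨⟨hH hP, hfP⟩, hP⟩, Q, ⟨⟨hH hQ, hfQ⟩, hQ⟩, hPQ⟩
  rw [← h1]
  congr 1
  ext X
  constructor
  · rintro ⟨h3, h4⟩
    exact ⟨⟨hH h3, h4⟩, h3⟩
  · rintro ⟨⟨-, h4⟩, h3⟩
    exact ⟨h3, h4⟩

lemma finite_represents (h2 : (2 : C) = 0) (hpo : polarForm p o = 1) (hfin : U.Finite) :
    {x : C × C | Represents U (framePoint p o x)}.Finite := by
  refine Set.Finite.of_finite_image (f := fun x : C × C =>
      Projectivization.mk C (framePoint p o x) (framePoint_ne_zero h2 hpo x))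
    (hfin.subset ?_) (framePoint_mk_injective h2 hpo).injOn
  rintro _ ⟨x, ⟨_, hx⟩, rfl⟩
  exact hx

lemma eps_mul_of_represents_framePoint (h2 : (2 : C) = 0) (hsq : ∀ x : C, x ^ 2 ∈ R)
    (hU : U ⊆ hermSet R (RingHom.id C) ε) (hpo : polarForm p o = 1)
    (hp : Represents U p) (ho : Represents U o) {x : C × C}
    (hx : Represents U (framePoint p o x)) : ∃ r ∈ R, x.2 + x.1 ^ 2 = ε * r := by
  obtain ⟨r₁, hr₁, e₁⟩ := form_mem_of_represents hsq hU hp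
  obtain ⟨r₂, hr₂, e₂⟩ := form_mem_of_represents hsq hU ho
  obtain ⟨r₃, hr₃, e₃⟩ := form_mem_of_represents hsq hU hx
  refine ⟨r₃ - r₂ - x.2 ^ 2 * r₁,
    R.sub_mem (R.sub_mem hr₃ hr₂) (R.mul_mem (hsq _) hr₁), ?_⟩
  simp only [framePoint, Pi.add_apply, Pi.smul_apply, smul_eq_mul, Matrix.cons_val] at e₃
  simp only [polarForm] at hpo
  linear_combination e₃ - e₂ - x.2 ^ 2 * e₁ - x.2 * hpo
    - (o 2 * x.2 * p 2 + o 2 * x.1 + x.2 * p 2 * x.1) * h2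

/-- A subunital is closed under the translations (with arbitrary center `p`) it determines. -/
lemma IsSubunital.represents_translate (hε : ε ∉ R) (h2 : (2 : C) = 0)
    (hsq : ∀ x : C, x ^ 2 ∈ R) (hq : 2 ≤ q) (hU : IsSubunital R (RingHom.id C) ε q U)
    (hpo : polarForm p o = 1) (hp : Represents U p) (ho : Represents U o) {s α w : C}
    (hs : Represents U (framePoint p o (0, s))) (ha : Represents U (framePoint p o (w, α)))
    (hw : w ≠ 0) : Represents U (framePoint p o (w, α + s)) := by
  classical
  have hfin : U.Finite := Set.finite_of_ncard_ne_zero (by rw [hU.2.1]; omega)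
  have hfinA := finite_represents h2 hpo hfin
  obtain ⟨hp0, hpU⟩ := hp
  set φ : C × C → Projectivization C (Fin 3 → C) := fun x =>
    Projectivization.mk C (framePoint p o x) (framePoint_ne_zero h2 hpo x) with hφ
  have hφi : Function.Injective φ := framePoint_mk_injective h2 hpo
  set A := hfinA.toFinset with hA
  have hmemA : ∀ x, x ∈ A ↔ Represents U (framePoint p o x) := fun x =>
    Set.Finite.mem_toFinset _
  have hmemφ : ∀ x, x ∈ A ↔ φ x ∈ U := fun x =>
    (hmemA x).trans ⟨fun h => h.2, fun h => ⟨_, h⟩⟩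
  have hφp : ∀ x, φ x ≠ Projectivization.mk C p hp0 := by
    intro x h
    obtain ⟨c, hc⟩ := (Projectivization.mk_eq_mk_iff' C _ _ _ _).mp h
    have h1 := polarForm_framePoint h2 hpo x
    rw [← hc] at h1
    simp only [polarForm, Pi.smul_apply, smul_eq_mul] at h1
    exact one_ne_zero (h1.symm.trans (by linear_combination c * p 0 * p 1 * h2))
  have hφs : ∀ X ∈ U, X ≠ Projectivization.mk C p hp0 → ∃ x, φ x = X := fun X hX hne =>
    exists_eq_framePoint hε h2 hsq hU.1 hpo hp0 hpU hX hne
  have ho' : framePoint p o (0, 0) = o := by simp [framePoint]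
  have hmemo : ((0 : C), (0 : C)) ∈ A := (hmemA _).mpr (by rw [ho']; exact ho)
  have himg : ∀ f : (Fin 3 → C) →ₗ[C] C, ∀ P : C × C → Prop, ∀ _ : DecidablePred P,
      (∀ x, f (framePoint p o x) = 0 ↔ P x) →
      Set.image φ (A.filter P : Finset (C × C)) =
        {X | X ∈ U ∧ f X.rep = 0} \ {Projectivization.mk C p hp0} := by
    intro f P _ hP
    ext X
    simp only [Set.mem_image, Finset.mem_coe, Finset.mem_filter, Set.mem_sdiff,
      Set.mem_ofPred_eq, Set.mem_singleton_iff]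
    constructor
    · rintro ⟨x, ⟨h1, h3⟩, rfl⟩
      exact ⟨⟨(hmemφ x).mp h1, (form_rep_mk f _ _).mpr ((hP x).mpr h3)⟩, hφp x⟩
    · rintro ⟨⟨h1, h3⟩, h4⟩
      obtain ⟨x, rfl⟩ := hφs X h1 h4
      exact ⟨x, ⟨(hmemφ x).mpr h1, (hP x).mp ((form_rep_mk f _ _).mp h3)⟩, rfl⟩
  have hcardimg : ∀ S : Finset (C × C), S.card = (Set.image φ (S : Set (C × C))).ncard := by
    intro S
    rw [Set.ncard_image_of_injective _ hφi, Set.ncard_coe_finset]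
  have key := affine_translate_mem hε h2 hsq hq A ?_ ?_ ?_ ?_ (w₀ := 0) (α₀ := 0) (s := s)
    (w₁ := w) (α₁ := α) hmemo (by rw [zero_add]; exact (hmemA _).mpr hs) ((hmemA _).mpr ha) hw
  · exact (hmemA _).mp key
  · have h1 := himg 0 (fun _ => True) inferInstance (by simp)
    rw [Finset.filter_true] at h1
    rw [hcardimg, h1]
    simp only [LinearMap.zero_apply, and_true, Set.ofPred_mem_eq]
    rw [Set.ncard_sdiff_singleton_of_mem hpU, hU.2.1, Nat.add_sub_cancel]
  · intro x hx
    exact eps_mul_of_represents_framePoint h2 hsq hU.1 hpo ⟨hp0, hpU⟩ ho ((hmemA x).mp hx)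
  · intro x hx
    have hf : frameForm p o 0 1 (-x.1) ≠ 0 := by
      intro h
      have := frameForm_horizontal (p := p) (o := o) 0 1 (-x.1)
      rw [h] at this
      simp at this
    have hfp : frameForm p o 0 1 (-x.1) (Projectivization.mk C p hp0).rep = 0 :=
      (form_rep_mk _ _ _).mpr (frameForm_vertical h2 hpo _ _ _)
    have hpl : Projectivization.mk C p hp0 ∈
        {X | X ∈ U ∧ frameForm p o 0 1 (-x.1) X.rep = 0} := ⟨hpU, hfp⟩
    have h1 := himg (frameForm p o 0 1 (-x.1)) (fun z => z.1 = x.1) inferInstance (by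
      intro z
      rw [frameForm_framePoint h2 hpo]
      constructor <;> intro h <;> linear_combination h)
    rw [hcardimg, h1, Set.ncard_sdiff_singleton_of_mem hpl,
      hU.line_ncard hf hpU ((hmemφ x).mp hx) (hφp x).symm hfp, Nat.add_sub_cancel]
    refine (form_rep_mk _ _ _).mpr ?_
    rw [frameForm_framePoint h2 hpo]; ring
  · intro x hx y hy hxy k b hxk hyk
    have hv := frameForm_vertical h2 hpo 1 (-k) (-b)
    have hf : frameForm p o 1 (-k) (-b) ≠ 0 := by
      intro h
      rw [h] at hv
      simp at hv
    have hiff : ∀ z : C × C, frameForm p o 1 (-k) (-b) (framePoint p o z) = 0 ↔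
        z.2 = k * z.1 + b := by
      intro z
      rw [frameForm_framePoint h2 hpo]
      constructor <;> intro h <;> linear_combination h
    rw [hcardimg, himg _ _ inferInstance hiff, Set.sdiff_singleton_eq_self]
    · exact hU.line_ncard hf ((hmemφ x).mp hx) ((hmemφ y).mp hy)
        (fun h => hxy (congrArg Prod.fst (hφi h)))
        ((form_rep_mk _ _ _).mpr ((hiff x).mpr hxk)) ((form_rep_mk _ _ _).mpr ((hiff y).mpr hyk))
    · rintro ⟨-, h⟩
      rw [form_rep_mk, hv] at h
      exact one_ne_zero h

/-- Conjugating a translation of a subunital yields a further point of the subunital. -/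
lemma IsSubunital.represents_conj (hε : ε ∉ R) (h2 : (2 : C) = 0)
    (hsq : ∀ x : C, x ^ 2 ∈ R) (hq : 2 ≤ q) (hU : IsSubunital R (RingHom.id C) ε q U)
    (hpo : polarForm p o = 1) (hp : Represents U p) (ho : Represents U o) {s α w : C}
    (hs : Represents U (framePoint p o (0, s))) (ha : Represents U (framePoint p o (w, α)))
    (hs0 : s ≠ 0) (hw : w ≠ 0) (hα : α ≠ 0) (hsα : s + α ≠ 0) :
    Represents U (framePoint p o (α * w / (s + α), α ^ 2 / (s + α))) := by
  have h1 := hU.represents_translate hε h2 hsq hq hpo hp ho hs ha hw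
  have hap : polarForm (framePoint p o (w, α)) p = 1 := by
    rw [polarForm_comm, polarForm_framePoint h2 hpo]
  have h3 : framePoint (framePoint p o (w, α)) p (0, s⁻¹) =
      s⁻¹ • framePoint p o (w, α + s) := by
    ext i
    simp only [framePoint, Pi.add_apply, Pi.smul_apply, smul_eq_mul]
    field_simp
    ring
  have h4 : framePoint (framePoint p o (w, α)) p (w / α, α⁻¹) = α⁻¹ • o := by
    ext i
    simp only [framePoint, Pi.add_apply, Pi.smul_apply, smul_eq_mul]
    field_simp
    linear_combination (α * p i + w * ![0, 0, 1] i) * h2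
  have h5 := hU.represents_translate hε h2 hsq hq hap ha hp
    (h3 ▸ represents_smul (inv_ne_zero hs0) h1) (h4 ▸ represents_smul (inv_ne_zero hα) ho)
    (div_ne_zero hw hα)
  have h6 := represents_smul (div_ne_zero (mul_ne_zero hs0 hα) hsα) h5
  convert h6 using 1
  ext i
  simp only [framePoint, Pi.add_apply, Pi.smul_apply, smul_eq_mul]
  field_simp
  linear_combination (-(s * α * p i) - s * w * ![0, 0, 1] i) * h2

lemma sq_mem_of_finrank_eq_two {t d : C} (hrank : Module.finrank R C = 2) (hε : ε ∉ R)
    (h2 : (2 : C) = 0) (hd : d ∈ R) (hmin : ε ^ 2 - t * ε + d = 0)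
    (htε : t = 2 * ε) (x : C) : x ^ 2 ∈ R := by
  have hli : LinearIndependent R ![(1 : C), ε] := by
    rw [LinearIndependent.pair_iff]
    rintro ⟨a, ha⟩ ⟨b, hb⟩ h
    simp only [Subfield.smul_def, smul_eq_mul, mul_one] at h
    have ha0 : a = 0 := eq_zero_of_eq_eps_mul hε ha (R.neg_mem hb) (by linear_combination h)
    have hε0 : ε ≠ 0 := fun h => hε (h ▸ R.zero_mem)
    have hb0 : b = 0 := by simpa [ha0, hε0] using h
    exact ⟨Subtype.ext ha0, Subtype.ext hb0⟩
  have : FiniteDimensional R C := Module.finite_of_finrank_pos (by omega)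
  have hspan := hli.span_eq_top_of_card_eq_finrank' (by simp [hrank])
  have hx : x ∈ Submodule.span R (Set.range ![(1 : C), ε]) := hspan ▸ Submodule.mem_top
  rw [Matrix.range_cons, Matrix.range_cons, Matrix.range_empty, Set.union_empty,
    Set.singleton_union, Submodule.mem_span_pair] at hx
  obtain ⟨⟨a, ha⟩, ⟨b, hb⟩, rfl⟩ := hx
  simp only [Subfield.smul_def, smul_eq_mul, mul_one]
  have : (a + b * ε) ^ 2 = a ^ 2 - b ^ 2 * d := by
    linear_combination (a * b * ε + b ^ 2 * ε ^ 2) * h2 + b ^ 2 * hmin + b ^ 2 * ε * htε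
  rw [this]
  exact R.sub_mem (R.pow_mem ha 2) (R.mul_mem (R.pow_mem hb 2) hd)

end Inseparable

/-- If `H(C|R)` contains a finite subunital, then `C|R` is separable, i.e. `σ ≠ id`. -/
theorem separable_of_subunital
    {C : Type*} [Field C] (R : Subfield C) (ε t d : C) (σ : C →+* C)
    (hrank : Module.finrank R C = 2)
    (hε : ε ∉ R) (ht : t ∈ R) (hd : d ∈ R)
    (hmin : ε ^ 2 - t * ε + d = 0)
    (hσR : ∀ r ∈ R, σ r = r) (hσε : σ ε = t - ε)
    (q : ℕ) (hq : 2 ≤ q)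
    (U : Set (Projectivization C (Fin 3 → C))) (hU : IsSubunital R σ ε q U) :
    σ ≠ RingHom.id C := by
  rintro rfl
  have h2 : (2 : C) = 0 := by
    by_contra h
    refine hε ?_
    have : ε = t / 2 := by
      rw [eq_div_iff h]
      simp only [RingHom.id_apply] at hσε
      linear_combination hσε
    rw [this]
    exact R.div_mem ht (by exact_mod_cast natCast_mem R 2)
  have hsq := sq_mem_of_finrank_eq_two hrank hε h2 hd hmin (by
    simp only [RingHom.id_apply] at hσε
    linear_combination -hσε)
  have hfin : U.Finite := Set.finite_of_ncard_ne_zero (by rw [hU.2.1]; omega)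
  have hq3 : q < q ^ 3 := lt_self_pow₀ (by omega) (by norm_num)
  obtain ⟨P, hP, O, hO, hPO⟩ : U.Nontrivial :=
    (Set.one_lt_ncard_iff_nontrivial_and_finite.mp (by rw [hU.2.1]; omega)).1
  obtain ⟨p, hp0, rfl⟩ : ∃ p, ∃ hp : p ≠ 0, Projectivization.mk C p hp = P :=
    ⟨P.rep, P.rep_nonzero, P.mk_rep⟩
  have hp : Represents U p := ⟨hp0, hP⟩
  have hpO : polarForm p O.rep ≠ 0 :=
    polarForm_ne_zero hε h2 hsq hU.1 hp0 O.rep_nonzero hP (by rwa [O.mk_rep]) (by rwa [O.mk_rep])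
  obtain ⟨o, ho⟩ : ∃ o, o = (polarForm p O.rep)⁻¹ • O.rep := ⟨_, rfl⟩
  have hoU : Represents U o := ho ▸ represents_smul (inv_ne_zero hpO) (represents_rep hO)
  have hpo : polarForm p o = 1 := by
    rw [ho, ← inv_mul_cancel₀ hpO]
    simp only [polarForm, Pi.smul_apply, smul_eq_mul]; ring
  have hpt : ∀ X ∈ U, X ≠ Projectivization.mk C p hp0 → ∃ x : C × C,
      Projectivization.mk C (framePoint p o x) (framePoint_ne_zero h2 hpo x) = X :=
    fun X hX hne => exists_eq_framePoint hε h2 hsq hU.1 hpo hp0 hP hX hne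
  obtain ⟨f, hf⟩ : ∃ f, f = frameForm p o 0 1 0 := ⟨_, rfl⟩
  have hfx : ∀ x, f (framePoint p o x) = x.1 := by
    intro x
    rw [hf, frameForm_framePoint h2 hpo]; ring
  have ho' : framePoint p o (0, 0) = o := by simp [framePoint]
  have hf0 : f ≠ 0 := by
    intro h
    have := frameForm_horizontal (p := p) (o := o) 0 1 0
    rw [← hf, h] at this
    simp at this
  have hfP : f (Projectivization.mk C p hp0).rep = 0 :=
    (form_rep_mk _ _ _).mpr (by rw [hf, frameForm_vertical h2 hpo])
  have hfO : f O.rep = 0 := by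
    have h : f o = 0 := by rw [← ho', hfx]
    rw [ho, map_smul, smul_eq_mul] at h
    exact (mul_eq_zero.mp h).resolve_left (inv_ne_zero hpO)
  have hline := hU.line_ncard hf0 hP hO hPO hfP hfO
  obtain ⟨s, hs, hs0⟩ : ∃ s, Represents U (framePoint p o (0, s)) ∧ s ≠ 0 := by
    obtain ⟨X, ⟨hXU, hXf⟩, hX⟩ := Set.exists_mem_notMem_of_ncard_lt_ncard
      (s := {Projectivization.mk C p hp0, O}) (t := {X | X ∈ U ∧ f X.rep = 0})
      (by rw [hline, Set.ncard_pair hPO]; omega)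
    simp only [Set.mem_insert_iff, Set.mem_singleton_iff, not_or] at hX
    obtain ⟨⟨w, s⟩, rfl⟩ := hpt X hXU hX.1
    rw [form_rep_mk, hfx] at hXf
    simp only at hXf
    subst hXf
    refine ⟨s, ⟨_, hXU⟩, ?_⟩
    rintro rfl
    apply hX.2
    conv_rhs => rw [← O.mk_rep]
    exact (Projectivization.mk_eq_mk_iff' C _ _ _ _).mpr ⟨_, ho.symm.trans ho'.symm⟩
  obtain ⟨w, α, ha, hw⟩ : ∃ w α, Represents U (framePoint p o (w, α)) ∧ w ≠ 0 := by
    obtain ⟨X, hXU, hX⟩ := Set.exists_mem_notMem_of_ncard_lt_ncard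
      (s := {X | X ∈ U ∧ f X.rep = 0}) (t := U) (by rw [hline, hU.2.1]; omega)
      (hfin.subset fun X h => h.1)
    obtain ⟨⟨w, α⟩, rfl⟩ := hpt X hXU (fun h => hX ⟨hXU, h ▸ hfP⟩)
    refine ⟨w, α, ⟨_, hXU⟩, fun h => hX ⟨hXU, ?_⟩⟩
    rw [form_rep_mk, hfx]
    exact h
  have hcoord : ∀ x : C × C, Represents U (framePoint p o x) → ∃ r ∈ R, x.2 + x.1 ^ 2 = ε * r :=
    fun x hx => eps_mul_of_represents_framePoint h2 hsq hU.1 hpo hp hoU hx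
  obtain ⟨r, hr, hsr⟩ := hcoord _ hs
  simp only [ne_eq, OfNat.ofNat_ne_zero, not_false_eq_true, zero_pow, add_zero] at hsr
  have hnot : ∀ {w α c : C}, Represents U (framePoint p o (w, α)) → w ≠ 0 → c ∈ R →
      α ≠ ε * c := by
    intro w α c ha hw hc h
    obtain ⟨r', hr', h'⟩ := hcoord _ ha
    exact hw (pow_eq_zero_iff two_ne_zero |>.mp (eq_zero_of_eq_eps_mul hε (hsq w)
      (R.sub_mem hr' hc) (by simp only at h'; linear_combination h' - h)))
  have hclosed : ∀ {w α : C}, Represents U (framePoint p o (w, α)) → w ≠ 0 →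
      Represents U (framePoint p o (α * w / (s + α), α ^ 2 / (s + α))) ∧
        α * w / (s + α) ≠ 0 := by
    intro w α ha hw
    have hα : α ≠ 0 := fun h => hnot ha hw R.zero_mem (by rw [h, mul_zero])
    have hsα : s + α ≠ 0 := fun h => hnot ha hw hr (by linear_combination h + hsr - s * h2)
    exact ⟨hU.represents_conj hε h2 hsq hq hpo hp hoU hs ha hs0 hw hα hsα,
      div_ne_zero (mul_ne_zero hα hw) hsα⟩
  obtain ⟨c, hc⟩ := exists_sq_of_finite_artinSchreier h2
    (T := Set.image (fun x : C × C => s / x.2) {x | Represents U (framePoint p o x) ∧ x.1 ≠ 0})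
    (((finite_represents h2 hpo hfin).subset fun x hx => hx.1).image _)
    (by
      rintro _ ⟨⟨w, α⟩, ⟨ha, hw⟩, rfl⟩
      have hα : α ≠ 0 := fun h => hnot ha hw R.zero_mem (by rw [h, mul_zero])
      obtain ⟨h1, h3⟩ := hclosed ha hw
      refine ⟨_, ⟨h1, h3⟩, ?_⟩
      have hsα : s + α ≠ 0 := fun h => h3 (by rw [h, div_zero])
      simp only
      field_simp
      ring)
    (x := s / α) ⟨(w, α), ⟨ha, hw⟩, rfl⟩
  have hα : α ≠ 0 := fun h => hnot ha hw R.zero_mem (by rw [h, mul_zero])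
  refine hnot ha hw (R.div_mem hr (hsq c)) ?_
  rw [← hc, ← mul_div_assoc, ← hsr]
  field_simp
end
end
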